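/- For every ε > 0 there exists an integer N such that the following holds for all n ≥ N. Let G be a graph on n vertices, set x := |G|/n² and suppose x ∈ [17/50, 7/20]. Suppose I ⊆ V(G) is an independent set, set α := |I|/n, and suppose α ∈ [1/3, 2/5] and d_G(v) ≥ n/5 for every v ∈ I. Then N(S₂, G)/n³ ≤ max{ (α³ + (2x − α²)·(2x + α²)^{1/2})/2 , ((1 − 2x)^{3/2} + 4x − 1)/2 } + ε. -/

import Mathlib

/-- A (simple) graph as a set of 2-element edges on `Fin n`. -/
def IsGraph2 {n : ℕ} (G : Finset (Finset (Fin n))) : Prop := ∀ e ∈ G, e.card = 2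

/-- The degree of a vertex in a graph given by its edge set. -/
def gdeg {n : ℕ} (G : Finset (Finset (Fin n))) (v : Fin n) : ℕ :=
  (G.filter fun e => v ∈ e).card

/-- The number of two-edge stars `S₂` (paths with two edges) in a graph:
`N(S₂, G) = ∑_v C(d_G(v), 2)`. -/
def numS2 {n : ℕ} (G : Finset (Finset (Fin n))) : ℕ :=
  ∑ v : Fin n, (gdeg G v).choose 2

/-- `I` is an independent set: no edge of `G` has both endpoints in `I`. -/
def IndepSet {n : ℕ} (G : Finset (Finset (Fin n))) (I : Finset (Fin n)) : Prop :=
  ∀ e ∈ G, ¬ e ⊆ I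

set_option maxHeartbeats 1000000 in
/-- Upper bound for the second degree moment of a weighted graph whose vertex set is split into a
high-degree part `H` (of measure equal to its degree threshold), an independent set `I` and a
remainder `K`: here `A` is the excess degree in `H`, `B` the total degree outside `H`, `y` the total
degree in `K`, and `W` the total excess of degrees over the threshold in `I`. -/
theorem exists_degree_split {V : Type*} [Fintype V] [DecidableEq V] (a : V → V → ℝ) (μ τ : ℝ)
    (hμ : 0 ≤ μ) (hμV : μ * Fintype.card V = 1)
    (ha0 : ∀ u v, 0 ≤ a u v) (ha1 : ∀ u v, a u v ≤ 1) (hsymm : ∀ u v, a u v = a v u)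
    (I H : Finset V) (hIH : Disjoint I H) (hI : ∀ u ∈ I, ∀ v ∈ I, a u v = 0)
    (D : V → ℝ) (hD : ∀ v, D v = μ * ∑ u, a v u)
    (hH : ∀ v ∈ H, μ * H.card ≤ D v) (hK : ∀ v, v ∉ I → v ∉ H → D v ≤ μ * H.card)
    (hτ : ∀ v ∈ I, τ ≤ D v) :
    ∃ c α A B y W : ℝ, c = μ * H.card ∧ α = μ * I.card ∧
      0 ≤ c ∧ c ≤ 1 - α ∧ 0 ≤ A ∧ 0 ≤ y ∧ y ≤ c * (1 - α - c) ∧ 0 ≤ W ∧ 2 * W ≤ B - A ∧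
      c ^ 2 + A + B = μ * ∑ v, D v ∧ B ≤ c * (1 - c) + W ∧
      ∀ p q p' q' : ℝ,
        (∀ z S, 0 ≤ z → z ≤ c → S ≤ A → S ≤ (1 - c) * z → S + z ^ 2 ≤ p + q * z) →
        (∀ z S, min τ c ≤ z → z ≤ c → S ≤ A → S ≤ (1 - c) * z → S ≤ α * z + y →
          S + z ^ 2 ≤ p' + q' * z) →
        μ * ∑ v, D v ^ 2 ≤ c ^ 3 + 2 * c * A + p * (1 - α - c) + q * y + p' * α +
          q' * (B - y - W) + (1 - α + c) * W := by
  classical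
  set K : Finset V := (I ∪ H)ᶜ with hKdef
  have hsplit : ∀ f : V → ℝ, ∑ v, f v = ∑ v ∈ H, f v + ∑ v ∈ K, f v + ∑ v ∈ I, f v := by
    intro f
    rw [← Finset.sum_add_sum_compl (I ∪ H) f, Finset.sum_union hIH]
    ring
  set dg : Finset V → V → ℝ := fun T v => μ * ∑ u ∈ T, a v u with hdg
  have hdg0 : ∀ T v, 0 ≤ dg T v := fun T v =>
    mul_nonneg hμ (Finset.sum_nonneg fun u _ => ha0 v u)
  have hdg1 : ∀ T v, dg T v ≤ μ * T.card := by
    intro T v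
    refine mul_le_mul_of_nonneg_left ?_ hμ
    calc ∑ u ∈ T, a v u ≤ ∑ u ∈ T, (1 : ℝ) := Finset.sum_le_sum fun u _ => ha1 v u
      _ = T.card := by simp
  have hswap : ∀ (S T : Finset V) (g : V → ℝ),
      ∑ v ∈ S, g v * dg T v = ∑ u ∈ T, μ * ∑ v ∈ S, a u v * g v := by
    intro S T g
    simp only [hdg, Finset.mul_sum]
    rw [Finset.sum_comm]
    refine Finset.sum_congr rfl fun u _ => Finset.sum_congr rfl fun v _ => ?_
    rw [hsymm v u]; ring
  have hswap1 : ∀ S T : Finset V, ∑ v ∈ S, dg T v = ∑ u ∈ T, dg S u := by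
    intro S T
    simpa using hswap S T (fun _ => 1)
  have hDsplit : ∀ v, D v = dg H v + dg K v + dg I v := by
    intro v; rw [hD, hsplit]; simp only [hdg]; ring
  have hdgI : ∀ v ∈ I, dg I v = 0 := by
    intro v hv
    simp only [hdg]
    rw [Finset.sum_eq_zero fun u hu => hI v hv u hu, mul_zero]
  set c := μ * (H.card : ℝ) with hc
  set α := μ * (I.card : ℝ) with hα
  have hcK : μ * (K.card : ℝ) = 1 - α - c := by
    have h := hsplit (fun _ => 1)
    simp only [Finset.sum_const, nsmul_eq_mul, mul_one, Finset.card_univ] at h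
    rw [hc, hα, ← hμV, h]; ring
  have hc0 : 0 ≤ c := by positivity
  have hα0 : 0 ≤ α := by positivity
  have hk0 : 0 ≤ 1 - α - c := by rw [← hcK]; positivity
  have hKmem : ∀ v ∈ K, D v ≤ c := by
    intro v hv
    have : v ∉ I ∧ v ∉ H := by simpa [hKdef, Finset.mem_union, not_or] using hv
    exact hK v this.1 this.2
  have hD1 : ∀ v, D v ≤ 1 := by
    intro v
    have h1 := hdg1 H v; have h2 := hdg1 K v; have h3 := hdg1 I v
    rw [hDsplit]; rw [hcK] at h2; linarith
  have hD0 : ∀ v, 0 ≤ D v := by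
    intro v; rw [hDsplit]; have := hdg0 H v; have := hdg0 K v; have := hdg0 I v; linarith
  have hDI : ∀ v ∈ I, D v ≤ 1 - α := by
    intro v hv
    have h1 := hdg1 H v; have h2 := hdg1 K v
    rw [hDsplit, hdgI v hv]; rw [hcK] at h2; linarith
  set g : V → ℝ := fun v => D v - c with hg
  have hg0 : ∀ v ∈ H, 0 ≤ g v := fun v hv => sub_nonneg.2 (hH v hv)
  set A := μ * ∑ v ∈ H, g v with hA
  set y := μ * ∑ v ∈ K, D v with hy
  set B := y + μ * ∑ v ∈ I, D v with hB
  set W := μ * ∑ v ∈ I, max (D v - c) 0 with hW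
  set S : V → ℝ := fun u => μ * ∑ v ∈ H, a u v * g v with hS
  have hA0 : 0 ≤ A := mul_nonneg hμ (Finset.sum_nonneg hg0)
  have hy0 : 0 ≤ y := mul_nonneg hμ (Finset.sum_nonneg fun v _ => hD0 v)
  have hW0 : 0 ≤ W := mul_nonneg hμ (Finset.sum_nonneg fun v _ => le_max_right _ _)
  have hyK : y ≤ c * (1 - α - c) := by
    rw [← hcK]
    calc y ≤ μ * ∑ v ∈ K, c := mul_le_mul_of_nonneg_left (Finset.sum_le_sum hKmem) hμ
      _ = _ := by simp; ring
  have hmin : ∀ v, min (D v) c + max (D v - c) 0 = D v := by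
    intro v
    rcases le_total (D v) c with h | h
    · rw [min_eq_left h, max_eq_right (by linarith)]; ring
    · rw [min_eq_right h, max_eq_left (by linarith)]; ring
  have hminsum : μ * ∑ v ∈ I, min (D v) c = B - y - W := by
    have : ∑ v ∈ I, D v = ∑ v ∈ I, min (D v) c + ∑ v ∈ I, max (D v - c) 0 := by
      rw [← Finset.sum_add_distrib]; exact Finset.sum_congr rfl fun v _ => (hmin v).symm
    rw [hB, hW, this]; ring
  have hAsum : μ * ∑ v ∈ H, D v = c ^ 2 + A := by
    rw [hA]; simp only [hg, Finset.sum_sub_distrib, Finset.sum_const, nsmul_eq_mul]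
    rw [mul_sub, ← mul_assoc, ← hc]; ring
  refine ⟨c, α, A, B, y, W, rfl, rfl, hc0, by linarith, hA0, hy0, hyK, hW0, ?_, ?_, ?_, ?_⟩
  · have hAle : A ≤ μ * ∑ v ∈ H, dg K v + μ * ∑ v ∈ H, dg I v := by
      rw [hA, ← mul_add, ← Finset.sum_add_distrib]
      refine mul_le_mul_of_nonneg_left (Finset.sum_le_sum fun v _ => ?_) hμ
      have := hdg1 H v; have := hDsplit v
      simp only [hg]; linarith
    have hWle : W ≤ μ * ∑ v ∈ I, dg K v := by
      refine mul_le_mul_of_nonneg_left (Finset.sum_le_sum fun v hv => ?_) hμ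
      have := hdg1 H v; have := hDsplit v; have := hdgI v hv
      exact max_le (by linarith) (hdg0 K v)
    have hyge : μ * ∑ v ∈ K, dg H v + μ * ∑ v ∈ K, dg I v ≤ y := by
      rw [hy, ← mul_add, ← Finset.sum_add_distrib]
      refine mul_le_mul_of_nonneg_left (Finset.sum_le_sum fun v _ => ?_) hμ
      have := hDsplit v; have := hdg0 K v; linarith
    have hIge : μ * ∑ v ∈ I, D v = μ * ∑ v ∈ I, dg H v + μ * ∑ v ∈ I, dg K v := by
      rw [← mul_add, ← Finset.sum_add_distrib]
      congr 1
      refine Finset.sum_congr rfl fun v hv => ?_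
      rw [hDsplit, hdgI v hv, add_zero]
    rw [hswap1 H K, hswap1 H I] at hAle
    rw [hswap1 K I] at hyge
    rw [hB, hIge]; linarith
  · rw [hsplit, hB, ← hAsum, hy]; ring
  · have : μ * ∑ v ∈ I, min (D v) c ≤ α * c := by
      calc μ * ∑ v ∈ I, min (D v) c ≤ μ * ∑ v ∈ I, c :=
            mul_le_mul_of_nonneg_left (Finset.sum_le_sum fun v _ => min_le_right _ _) hμ
        _ = _ := by simp [hα]; ring
    nlinarith
  · intro p q p' q' hp hp'
    have hSA : ∀ u, S u ≤ A := by
      intro u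
      refine mul_le_mul_of_nonneg_left (Finset.sum_le_sum fun v hv => ?_) hμ
      nlinarith [ha1 u v, hg0 v hv]
    have hSM : ∀ u, S u ≤ (1 - c) * dg H u := by
      intro u
      simp only [hS, hdg]
      rw [mul_left_comm]
      refine mul_le_mul_of_nonneg_left ?_ hμ
      rw [Finset.mul_sum]
      refine Finset.sum_le_sum fun v hv => ?_
      have := hD1 v
      rw [mul_comm]
      exact mul_le_mul_of_nonneg_right (by simp only [hg]; linarith) (ha0 u v)
    have hSy : ∀ u, S u ≤ α * dg H u + y := by
      intro u
      have h1 : ∀ v ∈ H, a u v * g v ≤ α * a u v + dg K v := by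
        intro v hv
        have h1 := hdg1 H v; have h2 := hDsplit v; have h3 := hdg1 I v
        have h4 := hdg0 K v
        have h5 : g v ≤ α + dg K v := by simp only [hg]; linarith
        nlinarith [ha0 u v, ha1 u v]
      calc S u ≤ μ * ∑ v ∈ H, (α * a u v + dg K v) :=
            mul_le_mul_of_nonneg_left (Finset.sum_le_sum h1) hμ
        _ = α * dg H u + μ * ∑ v ∈ K, dg H v := by
            rw [Finset.sum_add_distrib, hswap1 H K, ← Finset.mul_sum]; simp only [hdg]; ring
        _ ≤ α * dg H u + y := by
            gcongr α * dg H u + ?_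
            refine mul_le_mul_of_nonneg_left (Finset.sum_le_sum fun v _ => ?_) hμ
            have := hDsplit v; have := hdg0 K v; have := hdg0 I v; linarith
    have hc1 : 0 ≤ 1 - c := by linarith
    have hdgD : ∀ u, dg H u ≤ D u := by
      intro u; have := hDsplit u; have := hdg0 K u; have := hdg0 I u; linarith
    have hHsq : μ * ∑ v ∈ H, D v ^ 2 ≤
        c ^ 3 + 2 * c * A + μ * ∑ u ∈ K, S u + μ * ∑ u ∈ I, S u := by
      have h1 : ∑ v ∈ H, D v ^ 2 ≤
          ∑ v ∈ H, (c ^ 2 + 2 * c * g v + (g v * dg K v + g v * dg I v)) := by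
        refine Finset.sum_le_sum fun v hv => ?_
        have h1 := hdg1 H v; have h2 := hDsplit v; have h0 := hg0 v hv
        have h3 : g v ≤ dg K v + dg I v := by simp only [hg]; linarith
        have h4 : D v = c + g v := by simp [hg]
        rw [h4]; nlinarith
      calc μ * ∑ v ∈ H, D v ^ 2 ≤ _ := mul_le_mul_of_nonneg_left h1 hμ
        _ = _ := by
          rw [Finset.sum_add_distrib, Finset.sum_add_distrib, Finset.sum_add_distrib,
            hswap H K, hswap H I, ← Finset.mul_sum]
          simp only [Finset.sum_const, nsmul_eq_mul, hS, hA]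
          have : μ * (H.card : ℝ) = c := rfl
          linear_combination c ^ 2 * this
    have hKsq : μ * ∑ u ∈ K, S u + μ * ∑ u ∈ K, D u ^ 2 ≤ p * (1 - α - c) + q * y := by
      rw [← mul_add, ← Finset.sum_add_distrib]
      calc _ ≤ μ * ∑ u ∈ K, (p + q * D u) := by
            refine mul_le_mul_of_nonneg_left (Finset.sum_le_sum fun u hu => ?_) hμ
            exact hp _ _ (hD0 u) (hKmem u hu) (hSA u)
              ((hSM u).trans (mul_le_mul_of_nonneg_left (hdgD u) hc1))
        _ = _ := by
            rw [Finset.sum_add_distrib, ← Finset.mul_sum, ← hcK, hy]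
            simp only [Finset.sum_const, nsmul_eq_mul]; ring
    have hIsq : μ * ∑ u ∈ I, S u + μ * ∑ u ∈ I, D u ^ 2 ≤
        p' * α + q' * (B - y - W) + (1 - α + c) * W := by
      rw [← mul_add, ← Finset.sum_add_distrib]
      calc _ ≤ μ * ∑ u ∈ I, (p' + q' * min (D u) c + (1 - α + c) * max (D u - c) 0) := by
            refine mul_le_mul_of_nonneg_left (Finset.sum_le_sum fun u hu => ?_) hμ
            have hz : dg H u ≤ min (D u) c := le_min (hdgD u) (hdg1 H u)
            have h1 := hp' (min (D u) c) (S u) (min_le_min_right c (hτ u hu)) (min_le_right _ _)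
              (hSA u) ((hSM u).trans (mul_le_mul_of_nonneg_left hz hc1))
              ((hSy u).trans (by gcongr))
            have h2 := hDI u hu
            rcases le_total (D u) c with h | h
            · rw [min_eq_left h] at h1 ⊢
              rw [max_eq_right (by linarith)]; linarith
            · rw [min_eq_right h] at h1 ⊢
              rw [max_eq_left (by linarith)]; nlinarith
        _ = _ := by
            rw [Finset.sum_add_distrib, Finset.sum_add_distrib, ← Finset.mul_sum,
              ← Finset.mul_sum, ← hminsum, hW, hα]
            simp only [Finset.sum_const, nsmul_eq_mul]; ring
    rw [hsplit]
    linarith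

/-- The quasi-star bound: at most half of the vertices exceed the degree threshold. -/
theorem quasiStar_bound {b c x : ℝ} (hb : 0 ≤ b) (hbx : b ^ 2 = 1 - 2 * x) (hx : 17 / 50 ≤ x)
    (hx' : x ≤ 7 / 20) (hc : c ≤ 1 / 2) (hG : x - c ^ 2 / 2 ≤ c * (1 - c)) :
    c ^ 3 + (1 + c) * (x - c ^ 2 / 2) + (x - c ^ 2 / 2) ^ 2 / (1 - c) ≤ b ^ 3 + 4 * x - 1 := by
  have hx2 : x = (1 - b ^ 2) / 2 := by linarith
  subst hx2
  have h1 : 1 - c ≤ b := abs_le_of_sq_le_sq' (by nlinarith) hb |>.2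
  have hb1 : b ≤ 4 / 7 := by nlinarith
  rw [← sub_nonneg]
  have hq : 0 ≤ c ^ 2 - 2 * (1 + b) * c + 1 + 2 * b - b ^ 2 := by nlinarith
  have : b ^ 3 + 4 * ((1 - b ^ 2) / 2) - 1 - (c ^ 3 + (1 + c) * ((1 - b ^ 2) / 2 - c ^ 2 / 2) +
      ((1 - b ^ 2) / 2 - c ^ 2 / 2) ^ 2 / (1 - c)) =
      (c - 1 + b) ^ 2 * (c ^ 2 - 2 * (1 + b) * c + 1 + 2 * b - b ^ 2) / (4 * (1 - c)) := by
    have : 1 - c ≠ 0 := by linarith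
    field_simp
    ring
  rw [this]
  exact div_nonneg (mul_nonneg (sq_nonneg _) hq) (by linarith)

/-- A degree threshold between `c₀` and `c₁` is no better than the two extremes. -/
theorem threshold_le_max {c c₀ c₁ x : ℝ} (hx : 17 / 50 ≤ x) (hc0 : 1 / 2 ≤ c₀) (h0 : c₀ ≤ c)
    (h1 : c ≤ c₁) (hc1 : c₁ ≤ 3 / 5) :
    2 * x * c + x ^ 2 / c - c ^ 3 / 4 ≤
      max (2 * x * c₀ + x ^ 2 / c₀ - c₀ ^ 3 / 4) (2 * x * c₁ + x ^ 2 / c₁ - c₁ ^ 3 / 4) := by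
  have p0 : 0 < c₀ := by linarith
  have p : 0 < c := by linarith
  have p1 : 0 < c₁ := by linarith
  set k₀ := 2 * x - x ^ 2 / (c * c₀) - (c ^ 2 + c * c₀ + c₀ ^ 2) / 4 with hk0
  set k₁ := 2 * x - x ^ 2 / (c * c₁) - (c ^ 2 + c * c₁ + c₁ ^ 2) / 4 with hk1
  have e0 : 2 * x * c + x ^ 2 / c - c ^ 3 / 4 =
      2 * x * c₀ + x ^ 2 / c₀ - c₀ ^ 3 / 4 + (c - c₀) * k₀ := by
    rw [hk0]; field_simp; ring
  have e1 : 2 * x * c + x ^ 2 / c - c ^ 3 / 4 =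
      2 * x * c₁ + x ^ 2 / c₁ - c₁ ^ 3 / 4 - (c₁ - c) * k₁ := by
    rw [hk1]; field_simp; ring
  have hk : k₀ ≤ k₁ := by
    have : k₁ - k₀ = (c₁ - c₀) * (x ^ 2 / (c * c₀ * c₁) - (c + c₀ + c₁) / 4) := by
      rw [hk0, hk1]; field_simp; ring
    have h2 : (c + c₀ + c₁) / 4 ≤ x ^ 2 / (c * c₀ * c₁) := by
      rw [le_div_iff₀ (by positivity)]
      have h3 : c * c₀ * c₁ ≤ 3 / 5 * (3 / 5) * (3 / 5) := by gcongr <;> linarith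
      nlinarith
    nlinarith
  rcases le_total 0 k₁ with h | h
  · exact le_max_of_le_right (by nlinarith)
  · exact le_max_of_le_left (by nlinarith)

/-- Sign of the difference quotient of the first-slope bound when the remainder has degree sum
zero. -/
theorem slope_empty_nonpos {α c₁ c : ℝ} (hα : 1 / 3 ≤ α) (hα' : α ≤ 2 / 5)
    (hx : 17 / 25 ≤ c₁ ^ 2 + 2 * α * c₁) (hc1 : 51 / 100 ≤ c₁) (hc1' : c₁ ≤ 57 / 100)
    (hc : c₁ ≤ c) (hc' : c ≤ 1 - α) :
    α * (c₁ ^ 2 + 2 * α * c₁) - α ^ 2 * ((c + c₁) / 2) - 2 * α * c₁ * ((c + c₁) / 2)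
      + (c - c₁) * ((c + c₁) / 2) ^ 2 ≤ 0 := by
  nlinarith [mul_nonneg (sub_nonneg.2 hc) (sub_nonneg.2 hc'),
    mul_nonneg (sub_nonneg.2 hα) (sub_nonneg.2 hα'),
    mul_nonneg (sub_nonneg.2 hc) (sub_nonneg.2 hα), mul_nonneg (sub_nonneg.2 hc) (sub_nonneg.2 hα')]

/-- Sign of the difference quotient of the first-slope bound when the remainder has the largest
possible degree sum. -/
theorem slope_full_nonpos {α c₁ c : ℝ} (hα : 1 / 3 ≤ α) (hα' : α ≤ 2 / 5)
    (hx' : c₁ ^ 2 + 2 * α * c₁ ≤ 7 / 10) (hc1 : 51 / 100 ≤ c₁) (hc1' : c₁ ≤ 57 / 100)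
    (hc : c₁ ≤ c) :
    (c₁ ^ 2 + 2 * α * c₁) / 2 + (c + c₁) / 2 - (c ^ 2 + c * c₁ + c₁ ^ 2) / 2 -
      2 * α * (1 - α) ≤ 0 := by
  nlinarith [mul_nonneg (sub_nonneg.2 hα) (sub_nonneg.2 hα')]

/-- At the threshold `c₁`, the largest degree sum of the remainder is worse than zero. -/
theorem remainder_neg {α c₁ : ℝ} (hα : 1 / 3 ≤ α) (hα' : α ≤ 2 / 5)
    (hx : 17 / 25 ≤ c₁ ^ 2 + 2 * α * c₁) (hc1 : 51 / 100 ≤ c₁) :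
    α * (α + c₁ - 2 * c₁) + (1 - α - c₁) * c₁ < 0 := by
  by_contra! h
  nlinarith

/-- The estimate of `threshold_gap` at the largest threshold. -/
theorem threshold_gap_top {α c₁ : ℝ} (hα : 1 / 3 ≤ α) (hα' : α ≤ 2 / 5)
    (hx : 17 / 25 ≤ c₁ ^ 2 + 2 * α * c₁) (hx' : c₁ ^ 2 + 2 * α * c₁ ≤ 7 / 10)
    (hc1 : 51 / 100 ≤ c₁) (hc1' : c₁ ≤ 57 / 100) :
    α * (c₁ - α) * (1 - α) + (1 - α - c₁) * ((c₁ / 2 + α) ^ 2 - 3 / 4 * c₁ * (1 - α)) ≤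
      95 / 1000 * (1 - α) := by
  nlinarith [mul_nonneg (sub_nonneg.2 hα) (sub_nonneg.2 hα'),
    mul_nonneg (sub_nonneg.2 hα) (sub_nonneg.2 hc1),
    mul_nonneg (sub_nonneg.2 hα) (sub_nonneg.2 hc1'),
    mul_nonneg (sub_nonneg.2 hα) (sub_nonneg.2 hx), mul_nonneg (sub_nonneg.2 hα) (sub_nonneg.2 hx')]

/-- Growth of the threshold bound past `c₁`, in terms of difference quotients. -/
theorem threshold_gap {α c₁ c : ℝ} (hα : 1 / 3 ≤ α) (hα' : α ≤ 2 / 5)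
    (hx : 17 / 25 ≤ c₁ ^ 2 + 2 * α * c₁) (hx' : c₁ ^ 2 + 2 * α * c₁ ≤ 7 / 10)
    (hc1 : 51 / 100 ≤ c₁) (hc1' : c₁ ≤ 57 / 100) (hc : c₁ ≤ c) (hc' : c ≤ 1 - α) :
    α * (c₁ - α) * c + (c - c₁) * ((c₁ / 2 + α) ^ 2 - c * (c₁ / 2 + c / 4)) ≤ 95 / 1000 * c := by
  have h := threshold_gap_top hα hα' hx hx' hc1 hc1'
  have h2 : α * (c₁ - α) ≤ 8 / 100 := by nlinarith
  have h3 : 3 / 4 * c₁ * (1 - α - c₁) ^ 2 ≤ 8 / 1000 := by nlinarith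
  have h1 : α * (c₁ - α) * c₁ + 3 / 4 * c₁ * (1 - α - c₁) ^ 2 ≤ 95 / 1000 * c₁ := by nlinarith
  suffices hs : α * (c₁ - α) * c + (c - c₁) * ((c₁ / 2 + α) ^ 2 - 3 / 4 * c₁ * c)
      + 3 / 4 * c₁ * (1 - α - c) ^ 2 - 95 / 1000 * c ≤ 0 by
    have h4 : 0 ≤ c₁ * (1 - α - c) ^ 2 := by positivity
    have h5 : 0 ≤ c * (c - c₁) ^ 2 := mul_nonneg (by linarith) (sq_nonneg _)
    nlinarith
  rcases (hc.trans hc').eq_or_lt with e | l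
  · obtain rfl : c = c₁ := by linarith
    linarith
  · refine nonpos_of_mul_nonpos_right (a := 1 - α - c₁) ?_ (by linarith)
    linarith [mul_le_mul_of_nonneg_left h (sub_nonneg.2 hc),
      mul_le_mul_of_nonneg_left h1 (sub_nonneg.2 hc')]

/-- The estimate of `excess_le` for the largest `d`. -/
theorem excess_le_of_max {α e : ℝ} (hα : 1 / 3 ≤ α) (hα' : α ≤ 2 / 5) (he : 0 ≤ e)
    (hr : e ≤ 2353 / 10000 - 374 / 1000 * α) :
    95 / 1000 * (2353 / 10000 - 374 / 1000 * α - e) * (1 - α - e - 1 / 5) ≤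
      (88 / 100 * (2353 / 10000 - 374 / 1000 * α - e) + (1 - α - e) * e) *
        ((1 - α - e - 1 / 5) / 5 - 36 / 100 * (2353 / 10000 - 374 / 1000 * α - e) -
          (1 - α - e) * e) := by
  have ht : 0 ≤ α - 1 / 3 := by linarith
  have ht' : 0 ≤ 2 / 5 - α := by linarith
  have hr' := sub_nonneg.2 hr
  nlinarith [mul_nonneg ht ht', mul_nonneg ht he, mul_nonneg ht' he, mul_nonneg he hr',
    mul_nonneg ht hr', mul_nonneg ht' hr', mul_nonneg he (mul_nonneg ht hr'),
    mul_nonneg he (mul_nonneg he hr'), mul_nonneg he (mul_nonneg ht ht'),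
    sq_nonneg (e - 1 / 25), sq_nonneg (e * (e - 1 / 25))]

/-- The second factor in `excess_le` is nonnegative at `d = 0`. -/
theorem excess_factor_nonneg_of_zero {α e : ℝ} (hα : 1 / 3 ≤ α) (hα' : α ≤ 2 / 5) (he : 0 ≤ e)
    (hr : e ≤ 2353 / 10000 - 374 / 1000 * α) :
    0 ≤ (1 - α - e - 1 / 5) / 5 - (1 - α - e) * e := by
  nlinarith

/-- A convex quadratic is nonpositive on an interval if it is so at the end points. -/
theorem quad_nonpos {r s t m y : ℝ} (ht : 0 ≤ t) (h0 : r ≤ 0) (hm : r + s * m + t * m ^ 2 ≤ 0)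
    (hy : 0 ≤ y) (hym : y ≤ m) : r + s * y + t * y ^ 2 ≤ 0 := by
  rcases hy.eq_or_lt with rfl | hy
  · simpa using h0
  · refine nonpos_of_mul_nonpos_right (a := m) ?_ (hy.trans_le hym)
    have h1 := mul_nonneg (mul_nonneg ht (hy.le.trans hym)) (mul_nonneg hy.le (sub_nonneg.2 hym))
    linarith [mul_le_mul_of_nonneg_left h0 (sub_nonneg.2 hym), mul_le_mul_of_nonneg_left hm hy.le]

/-- The loss caused by the minimum degree in `I` exceeds the growth of the threshold bound. -/
theorem excess_le {α e d : ℝ} (hα : 1 / 3 ≤ α) (hα' : α ≤ 2 / 5) (he : 0 ≤ e) (hd : 0 ≤ d)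
    (hr : d + e ≤ 2353 / 10000 - 374 / 1000 * α) :
    95 / 1000 * d * (1 - α - e - 1 / 5) ≤ (88 / 100 * d + (1 - α - e) * e) *
      ((1 - α - e - 1 / 5) / 5 - 36 / 100 * d - (1 - α - e) * e) := by
  have h0 := excess_factor_nonneg_of_zero hα hα' he (by linarith)
  have h1 := excess_le_of_max hα hα' he (by linarith)
  have hc : 0 ≤ 1 - α - e := by linarith
  set l := 1 - α - e with hl
  have := quad_nonpos (r := - (l * e * ((l - 1 / 5) / 5 - l * e)))
    (s := 95 / 1000 * (l - 1 / 5) - 88 / 100 * ((l - 1 / 5) / 5 - l * e) + 36 / 100 * (l * e))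
    (t := 3168 / 10000)
    (m := 2353 / 10000 - 374 / 1000 * α - e) (y := d) (by norm_num)
    (neg_nonpos.2 (mul_nonneg (mul_nonneg hc he) h0)) (by linarith) hd (by linarith)
  linarith

/-- The second factor in `excess_le` is nonnegative. -/
theorem excess_factor_nonneg {α e d : ℝ} (hα : 1 / 3 ≤ α) (hα' : α ≤ 2 / 5) (he : 0 ≤ e)
    (hd : 0 ≤ d) (hr : d + e ≤ 2353 / 10000 - 374 / 1000 * α) :
    0 ≤ (1 - α - e - 1 / 5) / 5 - 36 / 100 * d - (1 - α - e) * e := by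
  nlinarith

/-- Threshold above the quasi-clique value, first slope. -/
theorem denseSlope_bound {α c₁ c y G : ℝ} (hα : 1 / 3 ≤ α) (hα' : α ≤ 2 / 5)
    (hx : 17 / 25 ≤ c₁ ^ 2 + 2 * α * c₁) (hx' : c₁ ^ 2 + 2 * α * c₁ ≤ 7 / 10)
    (hc1 : 51 / 100 ≤ c₁) (hc1' : c₁ ≤ 57 / 100) (hc : c₁ ≤ c) (hc' : c ≤ 1 - α)
    (hG : G = c₁ ^ 2 / 2 + α * c₁ - c ^ 2 / 2) (hy : 0 ≤ y) (hy' : y ≤ c * (1 - α - c)) :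
    c ^ 3 + 2 * c * G + α * G + y * (c + G / c) + (G - y) ^ 2 / α ≤
      c₁ ^ 3 + 3 * α * c₁ ^ 2 + α ^ 2 * c₁ := by
  have hα0 : 0 < α := by linarith
  have hc0 : 0 < c := by linarith
  have hd : 0 ≤ c - c₁ := by linarith
  have e0 : c ^ 3 + 2 * c * G + α * G + G ^ 2 / α - (c₁ ^ 3 + 3 * α * c₁ ^ 2 + α ^ 2 * c₁) =
      (c - c₁) * (α * (c₁ ^ 2 + 2 * α * c₁) - α ^ 2 * ((c + c₁) / 2)
        - 2 * α * c₁ * ((c + c₁) / 2) + (c - c₁) * ((c + c₁) / 2) ^ 2) / α := by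
    rw [hG]; field_simp; ring
  have h0 : c ^ 3 + 2 * c * G + α * G + G ^ 2 / α -
      (c₁ ^ 3 + 3 * α * c₁ ^ 2 + α ^ 2 * c₁) ≤ 0 := by
    rw [e0]
    exact div_nonpos_of_nonpos_of_nonneg (mul_nonpos_of_nonneg_of_nonpos hd
      (slope_empty_nonpos hα hα' hx hc1 hc1' hc hc')) hα0.le
  have hq : ∀ z : ℝ, α ^ 2 ≤ (c₁ ^ 2 + 2 * α * c₁) / 2 + z ^ 2 / 2 - (1 - α) * z := by
    intro z
    nlinarith [sq_nonneg (z - (1 - α)), mul_nonneg (sub_nonneg.2 hα) (sub_nonneg.2 hα')]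
  have em : c ^ 3 + 2 * c * G + α * G + G ^ 2 / α -
      (c₁ ^ 3 + 3 * α * c₁ ^ 2 + α ^ 2 * c₁) + (c + G / c - 2 * G / α) * (c * (1 - α - c))
        + 1 / α * (c * (1 - α - c)) ^ 2 =
      (c - c₁) * ((c₁ ^ 2 + 2 * α * c₁) / 2 + (1 - 2 * α) * ((c + c₁) / 2)
        - (c ^ 2 + c * c₁ + c₁ ^ 2) / 2 -
        (1 - α - (c + c₁) / 2) * (((c₁ ^ 2 + 2 * α * c₁) / 2 + c ^ 2 / 2 - (1 - α) * c) +
          ((c₁ ^ 2 + 2 * α * c₁) / 2 + c₁ ^ 2 / 2 - (1 - α) * c₁)) / α) +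
      (1 - α - c₁) * c₁ * (α * (α + c₁ - 2 * c₁) + (1 - α - c₁) * c₁) / α := by
    rw [hG]; field_simp; ring
  have hm : c ^ 3 + 2 * c * G + α * G + G ^ 2 / α -
      (c₁ ^ 3 + 3 * α * c₁ ^ 2 + α ^ 2 * c₁) + (c + G / c - 2 * G / α) * (c * (1 - α - c))
        + 1 / α * (c * (1 - α - c)) ^ 2 ≤ 0 := by
    rw [em]
    refine add_nonpos (mul_nonpos_of_nonneg_of_nonpos hd ?_)
      (div_nonpos_of_nonpos_of_nonneg (mul_nonpos_of_nonneg_of_nonpos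
        (mul_nonneg (by linarith) (by linarith))
        (remainder_neg hα hα' hx hc1).le) hα0.le)
    have h1 : (1 - α - (c + c₁) / 2) * (2 * α) ≤
        (1 - α - (c + c₁) / 2) * (((c₁ ^ 2 + 2 * α * c₁) / 2 + c ^ 2 / 2 - (1 - α) * c) +
          ((c₁ ^ 2 + 2 * α * c₁) / 2 + c₁ ^ 2 / 2 - (1 - α) * c₁)) / α := by
      rw [le_div_iff₀ hα0, mul_assoc]
      refine mul_le_mul_of_nonneg_left ?_ (by linarith)
      nlinarith [hq c, hq c₁]
    have := slope_full_nonpos hα hα' hx' hc1 hc1' hc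
    linarith
  have := quad_nonpos (t := 1 / α) (by positivity) h0 hm hy hy'
  have e : (G - y) ^ 2 / α = G ^ 2 / α - 2 * G / α * y + 1 / α * y ^ 2 := by ring
  rw [e]
  linarith

/-- Threshold above the quasi-clique value, second slope. -/
theorem looseSlope_bound {α c₁ c y G : ℝ} (hα : 1 / 3 ≤ α) (hα' : α ≤ 2 / 5)
    (hx : 17 / 25 ≤ c₁ ^ 2 + 2 * α * c₁) (hx' : c₁ ^ 2 + 2 * α * c₁ ≤ 7 / 10)
    (hc1 : 51 / 100 ≤ c₁) (hc1' : c₁ ≤ 57 / 100) (hc : c₁ ≤ c) (hc' : c ≤ 1 - α)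
    (hG : G = c₁ ^ 2 / 2 + α * c₁ - c ^ 2 / 2) (hy : 0 ≤ y) (hy' : y ≤ c * (1 - α - c)) :
    c ^ 3 + 3 * c * G + G ^ 2 / c -
        (α * c - G + y) * (1 / 5 - ((α * c - G) / (5 * c) + y) / (c - 1 / 5)) ≤
      c₁ ^ 3 + 3 * α * c₁ ^ 2 + α ^ 2 * c₁ := by
  have hα0 : 0 < α := by linarith
  have hc0 : 0 < c := by linarith
  have hd : 0 ≤ c - c₁ := by linarith
  have hl : 0 < c - 1 / 5 := by linarith
  have hγ : α * c - G = (c - c₁) * (α + (c + c₁) / 2) := by rw [hG]; ring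
  have hT : c ^ 3 + 3 * c * G + G ^ 2 / c - (c₁ ^ 3 + 3 * α * c₁ ^ 2 + α ^ 2 * c₁) ≤
      95 / 1000 * (c - c₁) := by
    have : c ^ 3 + 3 * c * G + G ^ 2 / c - (c₁ ^ 3 + 3 * α * c₁ ^ 2 + α ^ 2 * c₁) =
        (c - c₁) * (α * (c₁ - α) * c + (c - c₁) *
          ((c₁ / 2 + α) ^ 2 - c * (c₁ / 2 + c / 4))) / c := by
      rw [hG]; field_simp; ring
    rw [this, div_le_iff₀ hc0]
    linarith [mul_le_mul_of_nonneg_left (threshold_gap hα hα' hx hx' hc1 hc1' hc hc') hd]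
  have hr : (c - c₁) + (1 - α - c) ≤ 2353 / 10000 - 374 / 1000 * α := by nlinarith
  have hs : 88 / 100 * (c - c₁) ≤ α * c - G := by
    rw [hγ, mul_comm]
    exact mul_le_mul_of_nonneg_left (by nlinarith) hd
  have hs' : (α * c - G) / (5 * c) ≤ 36 / 100 * (c - c₁) := by
    rw [hγ, div_le_iff₀ (by positivity)]
    nlinarith
  have e : 1 - α - (1 - α - c) = c := by ring
  have kl := excess_le hα hα' (sub_nonneg.2 hc') hd hr
  have kp := excess_factor_nonneg hα hα' (sub_nonneg.2 hc') hd hr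
  rw [e] at kl kp
  have hm0 := mul_nonneg hc0.le (sub_nonneg.2 hc')
  have hl' : 3168 / 10000 * (c - c₁) ≤ 81 / 1000 * (c - 1 / 5) := by linarith
  generalize c - 1 / 5 = l at hl hl' kl kp ⊢
  generalize (α * c - G) / (5 * c) = v at hs' ⊢
  generalize α * c - G = g at hs ⊢
  generalize c * (1 - α - c) = m at kl kp hm0 hy' ⊢
  generalize c - c₁ = d at hs hs' kl kp hl' hT hd ⊢
  have key : ∀ z : ℝ, 95 / 1000 * d * l ≤ (88 / 100 * d + z) * (l / 5 - 36 / 100 * d - z) →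
      0 ≤ l / 5 - 36 / 100 * d - z → 0 ≤ z →
      95 / 1000 * d * l ≤ (g + z) * (l / 5 - v - z) := fun z h h' hz =>
    h.trans (mul_le_mul (by linarith) (by linarith) h' (by linarith))
  have k0 := key 0 (by nlinarith [mul_le_mul_of_nonneg_left hl' hd]) (by linarith) le_rfl
  have km := key m kl kp hm0
  have hq := quad_nonpos (r := 95 / 1000 * d * l - g * (l / 5 - v)) (s := g - (l / 5 - v))
    (t := 1) (by norm_num) (by linarith) (by linarith) hy hy'
  have hf : 95 / 1000 * d ≤ (g + y) * (1 / 5 - (v + y) / l) := by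
    have : (g + y) * (1 / 5 - (v + y) / l) = (g + y) * (l / 5 - v - y) / l := by
      field_simp
      ring
    rw [this, le_div_iff₀ hl]
    linarith
  linarith

/-- Linear majorant of `S + z ^ 2` for a small threshold. -/
theorem line_of_mul_le {A M c z S : ℝ} (hM : 0 < M) (hA : 0 ≤ A) (hcM : c ≤ M) (hz : 0 ≤ z)
    (hzc : z ≤ c) (hSA : S ≤ A) (hSM : S ≤ M * z) :
    S + z ^ 2 ≤ A / M * (M - c) + (c + A / M) * z := by
  obtain ⟨k, rfl⟩ : ∃ k, A = k * M := ⟨A / M, by field_simp⟩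
  rw [mul_div_assoc, div_self hM.ne', mul_one]
  rcases le_total z k with h | h
  · nlinarith [mul_nonneg (sub_nonneg.2 h) (by linarith : 0 ≤ M - c + z)]
  · nlinarith [mul_nonneg (sub_nonneg.2 h) (sub_nonneg.2 hzc)]

/-- Linear majorant of `S + z ^ 2` through the origin for a large threshold. -/
theorem line_of_le_mul {A M c z S : ℝ} (hc : 0 < c) (hM : M ≤ c) (hA : 0 ≤ A) (hAM : A ≤ c * M)
    (hz : 0 ≤ z) (hzc : z ≤ c) (hSA : S ≤ A) (hSM : S ≤ M * z) :
    S + z ^ 2 ≤ (A / c + c) * z := by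
  obtain ⟨k, rfl⟩ : ∃ k, A = c * k := ⟨A / c, by field_simp⟩
  rw [mul_div_assoc, mul_comm c (k / c), div_mul_cancel₀ _ hc.ne']
  have hk : k ≤ M := le_of_mul_le_mul_left hAM hc
  rcases le_total z k with h | h
  · nlinarith
  · nlinarith [mul_nonneg (sub_nonneg.2 h) (sub_nonneg.2 hzc)]

/-- Linear majorant of `S + z ^ 2` on `[τ, c]` that is attained at `z = c`. -/
theorem line_of_slope {α A c y τ z S σ : ℝ} (hα : 0 < α) (hτ : τ < c) (hz : τ ≤ z)
    (hzc : z ≤ c) (hSA : S ≤ A) (hSy : S ≤ α * z + y) (h1 : σ ≤ c + (A - y) / α)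
    (h2 : σ ≤ c + τ + (A - α * τ - y) / (c - τ)) :
    S + z ^ 2 ≤ A + c ^ 2 - σ * c + σ * z := by
  have h1' : α * (σ - c) ≤ A - y := by
    have := (le_div_iff₀ hα).1 (sub_le_iff_le_add'.2 h1); linarith
  have h2' : (σ - c - τ) * (c - τ) ≤ A - α * τ - y := by
    have hl : 0 < c - τ := by linarith
    exact (le_div_iff₀ hl).1 (by linarith)
  rcases le_total σ (c + z) with h | h
  · nlinarith [mul_nonneg (sub_nonneg.2 h) (sub_nonneg.2 hzc)]
  · have h0 : A - α * (σ - c) - y ≥ 0 := by linarith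
    have := quad_nonpos (t := 1) (r := -(A - α * τ - y - (σ - c - τ) * (c - τ)))
      (s := α + 2 * τ - σ) (m := σ - c - τ) (y := z - τ) zero_le_one (by linarith)
      (by linarith) (by linarith) (by linarith)
    linarith

/-- Bound for a degree threshold of at most one half. -/
theorem moment_le_quasiStar {α c x G ω W : ℝ} (hα : 1 / 3 ≤ α) (hx : 17 / 50 ≤ x) (hc : c ≤ 1 / 2)
    (hG : G = x - c ^ 2 / 2) (hW : 0 ≤ W) (hω : W ≤ ω) :
    c ^ 3 + 2 * c * (G - ω) + (1 - c) * ((G - ω) / (1 - c) * (1 - c - c)) +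
      (c + (G - ω) / (1 - c)) * (G + ω - W) + (1 - α + c) * W ≤
      c ^ 3 + (1 + c) * G + G ^ 2 / (1 - c) := by
  have hM : 0 < 1 - c := by linarith
  have e : c ^ 3 + (1 + c) * G + G ^ 2 / (1 - c) - (c ^ 3 + 2 * c * (G - ω) +
      (1 - c) * ((G - ω) / (1 - c) * (1 - c - c)) +
      (c + (G - ω) / (1 - c)) * (G + ω - W) + (1 - α + c) * W) =
      (ω * (ω - W) + (1 - c) ^ 2 * (ω - W) + W * (G + (α - c) * (1 - c))) / (1 - c) := by
    field_simp
    ring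
  have h : 0 ≤ G + (α - c) * (1 - c) := by rw [hG]; nlinarith
  have h' : 0 ≤ ω - W := by linarith
  have h'' : 0 ≤ ω := by linarith
  have : 0 ≤ (ω * (ω - W) + (1 - c) ^ 2 * (ω - W) + W * (G + (α - c) * (1 - c))) / (1 - c) := by
    positivity
  linarith

/-- Bound for an intermediate degree threshold. -/
theorem moment_le_threshold {α c x G ω W : ℝ} (hα : 1 / 3 ≤ α)
    (hx : 17 / 50 ≤ x) (hc0 : 0 < c) (hG : G = x - c ^ 2 / 2) (hW : 0 ≤ W) (hω : W ≤ ω) :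
    c ^ 3 + 2 * c * (G - ω) + ((G - ω) / c + c) * (G + ω - W) + (1 - α + c) * W ≤
      c ^ 3 + 3 * c * G + G ^ 2 / c := by
  have e : c ^ 3 + 3 * c * G + G ^ 2 / c - (c ^ 3 + 2 * c * (G - ω) +
      ((G - ω) / c + c) * (G + ω - W) + (1 - α + c) * W) =
      (c ^ 2 * (ω - W) + ω * (ω - W) + W * (c ^ 2 + G - (1 - α) * c)) / c := by
    field_simp
    ring
  have h : 0 ≤ c ^ 2 + G - (1 - α) * c := by rw [hG]; nlinarith [sq_nonneg (c - (1 - α))]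
  have h' : 0 ≤ ω - W := by linarith
  have h'' : 0 ≤ ω := by linarith
  have : 0 ≤ (c ^ 2 * (ω - W) + ω * (ω - W) + W * (c ^ 2 + G - (1 - α) * c)) / c := by positivity
  linarith

/-- Bound for a large degree threshold, first slope. -/
theorem moment_le_denseSlope {α c x G ω W y : ℝ} (hα : 1 / 3 ≤ α)
    (hx : 17 / 50 ≤ x) (hc0 : 0 < c) (hG : G = x - c ^ 2 / 2) (hW : 0 ≤ W) (hω : W ≤ ω)
    (hy : 0 ≤ y) (hy' : y ≤ c * (1 - α - c)) :
    c ^ 3 + 2 * c * (G - ω) + ((G - ω) / c + c) * y +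
        (G - ω + c ^ 2 - (c + (G - ω - y) / α) * c) * α +
        (c + (G - ω - y) / α) * (G + ω - y - W) + (1 - α + c) * W ≤
      c ^ 3 + 2 * c * G + α * G + y * (c + G / c) + (G - y) ^ 2 / α := by
  have hα0 : 0 < α := by linarith
  have e : c ^ 3 + 2 * c * G + α * G + y * (c + G / c) + (G - y) ^ 2 / α -
      (c ^ 3 + 2 * c * (G - ω) + ((G - ω) / c + c) * y +
        (G - ω + c ^ 2 - (c + (G - ω - y) / α) * c) * α +
        (c + (G - ω - y) / α) * (G + ω - y - W) + (1 - α + c) * W) =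
      ω * y / c + (ω * (ω - W) + α ^ 2 * (ω - W) +
        W * (G - y + α ^ 2 - (1 - α) * α)) / α := by
    field_simp
    ring
  have h : 0 ≤ G - y + α ^ 2 - (1 - α) * α := by
    rw [hG]
    nlinarith [sq_nonneg (c - (1 - α))]
  have h' : 0 ≤ ω - W := by linarith
  have h'' : 0 ≤ ω := by linarith
  have : 0 ≤ ω * y / c + (ω * (ω - W) + α ^ 2 * (ω - W) +
      W * (G - y + α ^ 2 - (1 - α) * α)) / α := by positivity
  linarith

/-- Bound for a large degree threshold, second slope. -/
theorem moment_le_looseSlope {α c x G ω W y : ℝ} (hα : 1 / 3 ≤ α)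
    (hx : 17 / 50 ≤ x) (hc : 1 / 2 ≤ c) (hc' : c ≤ 1 - α) (hG : G = x - c ^ 2 / 2) (hW : 0 ≤ W)
    (hω : W ≤ ω) (hy : 0 ≤ y) (hy' : y ≤ c * (1 - α - c)) :
    c ^ 3 + 2 * c * (G - ω) + ((G - ω) / c + c) * y +
        (G - ω + c ^ 2 - (c + 1 / 5 + (G - ω - α * (1 / 5) - y) / (c - 1 / 5)) * c) * α +
        (c + 1 / 5 + (G - ω - α * (1 / 5) - y) / (c - 1 / 5)) * (G + ω - y - W) +
        (1 - α + c) * W ≤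
      c ^ 3 + 3 * c * G + G ^ 2 / c -
        (α * c - G + y) * (1 / 5 - ((α * c - G) / (5 * c) + y) / (c - 1 / 5)) := by
  obtain ⟨l, hl⟩ : ∃ l, l = c - 1 / 5 := ⟨_, rfl⟩
  have hl0 : 0 < l := by linarith
  have hc0 : 0 < c := by linarith
  rw [← hl]
  have e : c ^ 3 + 3 * c * G + G ^ 2 / c -
        (α * c - G + y) * (1 / 5 - ((α * c - G) / (5 * c) + y) / l) -
      (c ^ 3 + 2 * c * (G - ω) + ((G - ω) / c + c) * y +
        (G - ω + c ^ 2 - (c + 1 / 5 + (G - ω - α * (1 / 5) - y) / l) * c) * α +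
        (c + 1 / 5 + (G - ω - α * (1 / 5) - y) / l) * (G + ω - y - W) +
        (1 - α + c) * W) =
      ω * y / c + (ω * (ω - W) + l ^ 2 * (ω - W) +
        W * (l * (2 * α + c - 1) - (α * c - G + y))) / l := by
    obtain rfl : c = l + 1 / 5 := by linarith
    field_simp
    ring
  have h : 0 ≤ l * (2 * α + c - 1) - (α * c - G + y) := by
    rw [hG, hl]
    nlinarith
  have h' : 0 ≤ ω - W := by linarith
  have h'' : 0 ≤ ω := by linarith
  have : 0 ≤ ω * y / c + (ω * (ω - W) + l ^ 2 * (ω - W) +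
        W * (l * (2 * α + c - 1) - (α * c - G + y))) / l := by positivity
  linarith

/-- Optimising the split bound over all parameters, for minimum degree `1 / 5` inside the
independent set; `c₁` is the threshold of the complement-of-a-clique construction. -/
theorem moment_le_max {α b c c₁ x A B y W Q : ℝ} (hα : 1 / 3 ≤ α) (hα' : α ≤ 2 / 5)
    (hx : 17 / 50 ≤ x) (hx' : x ≤ 7 / 20) (hb : 0 ≤ b) (hbx : b ^ 2 = 1 - 2 * x)
    (hc₁ : 0 ≤ c₁) (hc₁x : c₁ ^ 2 + 2 * α * c₁ = 2 * x)
    (hc0 : 0 ≤ c) (hcα : c ≤ 1 - α) (hA : 0 ≤ A) (hy : 0 ≤ y) (hy' : y ≤ c * (1 - α - c))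
    (hW : 0 ≤ W) (hAB : 2 * W ≤ B - A) (hx2 : c ^ 2 + A + B = 2 * x) (hB : B ≤ c * (1 - c) + W)
    (hQ : ∀ p q p' q' : ℝ,
        (∀ z S, 0 ≤ z → z ≤ c → S ≤ A → S ≤ (1 - c) * z → S + z ^ 2 ≤ p + q * z) →
        (∀ z S, min (1 / 5) c ≤ z → z ≤ c → S ≤ A → S ≤ (1 - c) * z → S ≤ α * z + y →
          S + z ^ 2 ≤ p' + q' * z) →
        Q ≤ c ^ 3 + 2 * c * A + p * (1 - α - c) + q * y + p' * α +
          q' * (B - y - W) + (1 - α + c) * W) :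
    Q ≤ max (c₁ ^ 3 + 3 * α * c₁ ^ 2 + α ^ 2 * c₁) (b ^ 3 + 4 * x - 1) := by
  obtain ⟨G, hG⟩ : ∃ G, G = x - c ^ 2 / 2 := ⟨_, rfl⟩
  obtain ⟨ω, rfl⟩ : ∃ ω, A = G - ω := ⟨G - A, by ring⟩
  obtain rfl : B = G + ω := by linarith
  have hω : W ≤ ω := by linarith
  have hGc : x - c ^ 2 / 2 ≤ c * (1 - c) := by linarith
  have hAc : G - ω ≤ c * (1 - c) := by linarith
  have hl : 51 / 100 ≤ c₁ := by nlinarith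
  have hu : c₁ ≤ 57 / 100 := by nlinarith
  have hmin : 0 ≤ min (1 / 5) c := le_min (by norm_num) hc0
  rcases le_total c (1 / 2) with h | h
  · have hline : ∀ z S, 0 ≤ z → z ≤ c → S ≤ G - ω → S ≤ (1 - c) * z →
        S + z ^ 2 ≤ (G - ω) / (1 - c) * (1 - c - c) + (c + (G - ω) / (1 - c)) * z :=
      fun z S h1 h2 h3 h4 => line_of_mul_le (by linarith) hA (by linarith) h1 h2 h3 h4
    have h1 := hQ _ _ _ _ hline fun z S hz h2 h3 h4 _ => hline z S (hmin.trans hz) h2 h3 h4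
    have h2 := moment_le_quasiStar hα hx h hG hW hω
    have h3 := quasiStar_bound hb hbx hx hx' h hGc
    rw [← hG] at h3
    exact le_max_of_le_right (by linarith)
  have hcp : 0 < c := by linarith
  have hline : ∀ z S, 0 ≤ z → z ≤ c → S ≤ G - ω → S ≤ (1 - c) * z →
      S + z ^ 2 ≤ 0 + ((G - ω) / c + c) * z := fun z S h1 h2 h3 h4 => by
    rw [zero_add]
    exact line_of_le_mul hcp (by linarith) hA hAc h1 h2 h3 h4
  rcases le_total c c₁ with h' | h'
  · have h1 := hQ _ _ _ _ hline fun z S hz h2 h3 h4 _ => hline z S (hmin.trans hz) h2 h3 h4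
    have h2 := moment_le_threshold hα hx hcp hG hW hω
    have h3 := threshold_le_max hx le_rfl h h' (by linarith)
    have h4 := quasiStar_bound (c := 1 / 2) hb hbx hx hx' le_rfl (by linarith)
    have e : c ^ 3 + 3 * c * G + G ^ 2 / c = 2 * x * c + x ^ 2 / c - c ^ 3 / 4 := by
      rw [hG]
      field_simp
      ring
    have e' : 2 * x * c₁ + x ^ 2 / c₁ - c₁ ^ 3 / 4 = c₁ ^ 3 + 3 * α * c₁ ^ 2 + α ^ 2 * c₁ := by
      obtain rfl : x = (c₁ ^ 2 + 2 * α * c₁) / 2 := by linarith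
      have : c₁ ≠ 0 := by linarith
      field_simp
      ring
    rw [e'] at h3
    refine le_trans ?_ (h3.trans ((max_comm _ _).trans_le (max_le_max le_rfl ?_)))
    · linarith
    · ring_nf at h4 ⊢
      linarith
  · refine le_max_of_le_left ?_
    have hG' : G = c₁ ^ 2 / 2 + α * c₁ - c ^ 2 / 2 := by linarith
    have hm : min (1 / 5) c = 1 / 5 := min_eq_left (by linarith)
    have h1 : ∀ σ, σ ≤ c + (G - ω - y) / α →
        σ ≤ c + 1 / 5 + (G - ω - α * (1 / 5) - y) / (c - 1 / 5) → _ := fun σ s1 s2 =>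
      hQ _ _ (G - ω + c ^ 2 - σ * c) σ hline fun z S hz h2 h3 _ h5 =>
        line_of_slope (by linarith) (by linarith) (hm ▸ hz) h2 h3 h5 s1 s2
    rcases le_total (c + (G - ω - y) / α)
      (c + 1 / 5 + (G - ω - α * (1 / 5) - y) / (c - 1 / 5)) with s | s
    · have := h1 _ le_rfl s
      have h2 := moment_le_denseSlope hα hx hcp hG hW hω hy hy'
      have h3 := denseSlope_bound hα hα' (by linarith) (by linarith) hl hu h' hcα hG' hy hy'
      linarith
    · have := h1 _ s le_rfl
      have h2 := moment_le_looseSlope hα hx h hcα hG hW hω hy hy'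
      have h3 := looseSlope_bound hα hα' (by linarith) (by linarith) hl hu h' hcα hG' hy hy'
      linarith

/-- Double counting of incidences. -/
theorem sum_gdeg {n : ℕ} {G : Finset (Finset (Fin n))} (hG : IsGraph2 G) :
    ∑ v, gdeg G v = 2 * G.card := by
  simp only [gdeg, Finset.card_filter]
  rw [Finset.sum_comm, Finset.sum_congr rfl (g := fun _ => 2)]
  · simp [mul_comm]
  · intro e he
    rw [← hG e he]
    simp

/-- Degrees are row sums of the adjacency indicator. -/
theorem gdeg_eq_sum {n : ℕ} {G : Finset (Finset (Fin n))} (hG : IsGraph2 G) (v : Fin n) :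
    (gdeg G v : ℝ) = ∑ u, if u ≠ v ∧ {v, u} ∈ G then (1 : ℝ) else 0 := by
  rw [Finset.sum_boole, gdeg, Nat.cast_inj]
  symm
  refine Finset.card_bij (fun u _ => {v, u}) ?_ ?_ ?_
  · intro u hu
    simp_all
  · intro u hu w hw h
    have : u ∈ ({v, w} : Finset (Fin n)) := by rw [← h]; simp
    simp_all
  · intro e he
    obtain ⟨he, hv⟩ := Finset.mem_filter.1 he
    obtain ⟨s, t, hst, rfl⟩ := Finset.card_eq_two.1 (hG e he)
    rcases Finset.mem_insert.1 hv with rfl | hv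
    · exact ⟨t, by simp [he, hst.symm], rfl⟩
    · obtain rfl := Finset.mem_singleton.1 hv
      exact ⟨s, by simp [Finset.pair_comm, he, hst], Finset.pair_comm _ _⟩

/-- In any set, there are `m` elements of value at least `m` such that all others have value at
most `m`. -/
theorem exists_hIndex_subset {V : Type*} [DecidableEq V] (J : Finset V) (d : V → ℕ) :
    ∃ H ⊆ J, (∀ v ∈ H, H.card ≤ d v) ∧ ∀ v ∈ J, v ∉ H → d v ≤ H.card := by
  have h0 : 0 ≤ (J.filter fun v => 0 ≤ d v).card := Nat.zero_le _
  obtain ⟨m, hm, hm'⟩ : ∃ m, m ≤ (J.filter fun v => m ≤ d v).card ∧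
      (J.filter fun v => m + 1 ≤ d v).card ≤ m := by
    by_contra! h
    have : ∀ m, m ≤ (J.filter fun v => m ≤ d v).card := by
      intro m
      induction m with
      | zero => exact h0
      | succ k ih => exact h k ih
    exact absurd ((this (J.card + 1)).trans (Finset.card_filter_le _ _)) (by omega)
  obtain ⟨H, h1, h2, rfl⟩ := Finset.exists_subsuperset_card_eq
    (Finset.monotone_filter_right J fun v _ (h : m + 1 ≤ d v) => (Nat.le_succ m).trans h) hm' hm
  refine ⟨H, h2.trans (Finset.filter_subset _ _), fun v hv => (Finset.mem_filter.1 (h2 hv)).2, ?_⟩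
  intro v hv hvH
  by_contra! h
  exact hvH (h1 (Finset.mem_filter.2 ⟨hv, h⟩))

/-- The number of two-edge stars is at most half the second degree moment. -/
theorem numS2_le {n : ℕ} (G : Finset (Finset (Fin n))) :
    (numS2 G : ℝ) ≤ (∑ v, (gdeg G v : ℝ) ^ 2) / 2 := by
  rw [numS2, Nat.cast_sum, Finset.sum_div]
  refine Finset.sum_le_sum fun v _ => ?_
  rw [Nat.cast_choose_two]
  nlinarith [(Nat.cast_nonneg (gdeg G v) : (0 : ℝ) ≤ _)]

/-- Refined star-counting bound: for every ε > 0 there is N such that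
for n ≥ N, a graph G on n vertices with edge density `x = |G|/n² ∈ [17/50, 7/20]` and an
independent set I of relative size `α = |I|/n ∈ [1/3, 2/5]` all of whose vertices have
degree at least n/5 satisfies
`N(S₂,G)/n³ ≤ max{ (α³ + (2x − α²)√(2x + α²))/2, ((1 − 2x)^{3/2} + 4x − 1)/2 } + ε`. -/
theorem star_count_refined_two (ε : ℝ) (hε : 0 < ε) :
    ∃ N : ℕ, ∀ n : ℕ, N ≤ n →
      ∀ (G : Finset (Finset (Fin n))) (I : Finset (Fin n)) (x α : ℝ),
        IsGraph2 G → IndepSet G I →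
        x = (G.card : ℝ) / (n : ℝ) ^ 2 → α = (I.card : ℝ) / (n : ℝ) →
        17 / 50 ≤ x → x ≤ 7 / 20 → 1 / 3 ≤ α → α ≤ 2 / 5 →
        (∀ v ∈ I, (n : ℝ) / 5 ≤ (gdeg G v : ℝ)) →
        (numS2 G : ℝ) / (n : ℝ) ^ 3 ≤
          max ((α ^ 3 + (2 * x - α ^ 2) * Real.sqrt (2 * x + α ^ 2)) / 2)
            ((Real.sqrt ((1 - 2 * x) ^ 3) + 4 * x - 1) / 2) + ε := by
  refine ⟨1, fun n hn G I x α hG hI hx hα hx1 hx2 hα1 hα2 hdeg => ?_⟩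
  have hn0 : (0 : ℝ) < n := by exact_mod_cast hn
  obtain ⟨H, hHI, hH, hK⟩ := exists_hIndex_subset Iᶜ (gdeg G)
  have hsum : ∑ v, (gdeg G v : ℝ) = 2 * G.card := by exact_mod_cast sum_gdeg hG
  obtain ⟨c, α', A, B, y, W, -, hα', hc0, hcα, hA, hy, hy', hW, hAB, hx3, hB, hQ⟩ :=
    exists_degree_split (fun v u => if u ≠ v ∧ {v, u} ∈ G then (1 : ℝ) else 0) (1 / n) (1 / 5)
      (by positivity) (by simp [hn0.ne']) (fun u v => by positivity)
      (fun u v => by split_ifs <;> norm_num)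
      (fun u v => by simp only [Finset.pair_comm u v, ne_comm (a := u)]) I H
      (Finset.disjoint_left.2 fun v hv hv' => Finset.mem_compl.1 (hHI hv') hv)
      (fun u hu v hv => if_neg fun h => hI _ h.2 (by
        rw [Finset.insert_subset_iff, Finset.singleton_subset_iff]; exact ⟨hu, hv⟩))
      (fun v => 1 / n * gdeg G v) (fun v => by rw [gdeg_eq_sum hG])
      (fun v hv => by have := hH v hv; gcongr)
      (fun v hv hv' => by have := hK v (Finset.mem_compl.2 hv) hv'; gcongr)
      (fun v hv => by
        have := mul_le_mul_of_nonneg_left (hdeg v hv) (one_div_pos.2 hn0).le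
        refine le_trans (le_of_eq ?_) this
        field_simp)
  obtain rfl : α' = α := by rw [hα', hα]; ring
  have hs : 0 < 2 * x + α' ^ 2 := by positivity
  have hs' := Real.sq_sqrt hs.le
  have hb' := Real.sq_sqrt (by linarith : 0 ≤ 1 - 2 * x)
  have hx4 : c ^ 2 + A + B = 2 * x := by
    rw [hx3, ← Finset.mul_sum, hsum, hx]
    field_simp
  have key := moment_le_max (c₁ := √(2 * x + α' ^ 2) - α') hα1 hα2 hx1 hx2
    (Real.sqrt_nonneg (1 - 2 * x)) hb' (sub_nonneg.2 (Real.le_sqrt_of_sq_le (by linarith)))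
    (by linarith) hc0 hcα hA hy hy' hW hAB hx4 hB hQ
  have e1 : (√(2 * x + α' ^ 2) - α') ^ 3 + 3 * α' * (√(2 * x + α' ^ 2) - α') ^ 2 +
      α' ^ 2 * (√(2 * x + α' ^ 2) - α') = α' ^ 3 + (2 * x - α' ^ 2) * √(2 * x + α' ^ 2) := by
    linear_combination √(2 * x + α' ^ 2) * hs'
  have e2 : √((1 - 2 * x) ^ 3) = √(1 - 2 * x) ^ 3 := by
    rw [Real.sqrt_eq_iff_mul_self_eq (pow_nonneg (by linarith) 3) (by positivity)]
    linear_combination -(√(1 - 2 * x) ^ 4 + √(1 - 2 * x) ^ 2 * (1 - 2 * x) + (1 - 2 * x) ^ 2) * hb'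
  rw [e1, ← e2] at key
  have hN : (numS2 G : ℝ) / n ^ 3 ≤ (1 / n * ∑ v, (1 / n * (gdeg G v : ℝ)) ^ 2) / 2 := by
    rw [div_le_iff₀ (by positivity)]
    refine (numS2_le G).trans (le_of_eq ?_)
    simp only [mul_pow, ← Finset.mul_sum]
    field_simp
  rw [max_div_div_right (by norm_num : (0 : ℝ) ≤ 2)]
  linarith
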